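/- arXiv:0710.1208 — 4 statements merged into one kernel-verified Lean document; each statement's English description precedes it below -/
import Mathlib

section
/- Let F ⊣ U : S ⇆ T be an adjunction where the category S is cocomplete, and let W be the class of morphisms τ of S such that F τ is an isomorphism in T. Then U is full and faithful if and only if F exhibits T as the localization of S with respect to W (equivalently, the induced functor S[W⁻¹] → T from the localized category to T is an equivalence of categories). -/
open CategoryTheory

/-- The class of `F`-isomorphisms: morphisms `τ` of `S` such that `F τ` is an
isomorphism in `T`. -/
def fIsomorphisms {S : Type*} {T : Type*} [Category S] [Category T] (F : S ⥤ T) :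
    MorphismProperty S :=
  fun _ _ τ => IsIso (F.map τ)

/-- If the left adjoint `F` is a localization functor, then the counit of the adjunction is an
isomorphism. -/
theorem isIso_counit_of_isLocalization {S : Type*} {T : Type*} [Category S] [Category T]
    {F : S ⥤ T} {U : T ⥤ S} (adj : F ⊣ U) (W : MorphismProperty S) [F.IsLocalization W] :
    IsIso adj.counit := by
  let ρ : 𝟭 T ⟶ U ⋙ F := (Localization.fullyFaithfulWhiskeringLeft F W T).preimage
    (X := 𝟭 T) (Y := U ⋙ F)
    { app := fun X => F.map (adj.unit.app X)
      naturality := fun X Y f => by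
        have h := adj.unit.naturality f
        dsimp at h ⊢
        rw [← F.map_comp, ← F.map_comp, h] }
  have ρ_app (X : S) : ρ.app (F.obj X) = F.map (adj.unit.app X) :=
    NatTrans.congr_app ((Localization.fullyFaithfulWhiskeringLeft F W T).map_preimage
      (X := 𝟭 T) (Y := U ⋙ F) _) X
  refine ⟨ρ, ?_, ?_⟩
  · ext Y
    have h := ρ.naturality (adj.counit.app Y)
    dsimp at h ⊢
    rw [h, ρ_app, ← F.map_comp, adj.right_triangle_components]
    exact F.map_id _
  · refine Localization.natTrans_ext F W fun X => ?_
    dsimp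
    rw [ρ_app]
    exact adj.left_triangle_components X

/-- Let `F ⊣ U : S ⇆ T` be an adjunction with `S` cocomplete, and `W` the class
of morphisms `τ` of `S` such that `F τ` is an isomorphism. Then `U` is full and faithful iff
`F` exhibits `T` as the localization of `S` with respect to `W`. -/
theorem stmt2 {S : Type*} {T : Type*} [Category S] [Category T]
    (F : S ⥤ T) (U : T ⥤ S) (adj : F ⊣ U) [Limits.HasColimits S] :
    (U.Full ∧ U.Faithful) ↔ F.IsLocalization (fIsomorphisms F) := by
  constructor
  · rintro ⟨_, _⟩
    exact adj.isLocalization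
  · intro h
    have := isIso_counit_of_isLocalization adj (fIsomorphisms F)
    have hU := adj.fullyFaithfulROfIsIsoCounit
    exact ⟨hU.full, hU.faithful⟩
end

section
/- Let F ⊣ U : S ⇆ T be an adjunction with S cocomplete, and let W be the class of morphisms τ of S such that F τ is an isomorphism. Then W admits a left calculus of fractions: W contains all identities and is closed under composition; for every τ : Σ → Σ' in W and every σ : Σ → Σ₁ there exist σ' : Σ' → Σ'₁ and τ' : Σ₁ → Σ'₁ with τ' ∈ W and σ' ∘ τ = τ' ∘ σ; and for every τ : Σ → Σ' in W and parallel morphisms f, g : Σ' → Σ'' with f ∘ τ = g ∘ τ there exists τ'' : Σ'' → Σ''' in W with τ'' ∘ f = τ'' ∘ g. -/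
open CategoryTheory

/-- For an adjunction `F ⊣ U : S ⇆ T` with `S` cocomplete, the class `W` of
`F`-isomorphisms admits a left calculus of fractions: it contains all identities, is closed
under composition, satisfies the left Ore condition, and the left cancellation condition. -/
theorem stmt4 {S : Type*} {T : Type*} [Category S] [Category T]
    (F : S ⥤ T) (U : T ⥤ S) (adj : F ⊣ U) [Limits.HasColimits S] :
    (∀ X : S, IsIso (F.map (𝟙 X))) ∧
    (∀ {X Y Z : S} (f : X ⟶ Y) (g : Y ⟶ Z),
      IsIso (F.map f) → IsIso (F.map g) → IsIso (F.map (f ≫ g))) ∧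
    (∀ {X X' X₁ : S} (τ : X ⟶ X') (σ : X ⟶ X₁), IsIso (F.map τ) →
      ∃ (X'₁ : S) (σ' : X' ⟶ X'₁) (τ' : X₁ ⟶ X'₁),
        IsIso (F.map τ') ∧ τ ≫ σ' = σ ≫ τ') ∧
    (∀ {X X' X'' : S} (τ : X ⟶ X') (f g : X' ⟶ X''), IsIso (F.map τ) → τ ≫ f = τ ≫ g →
      ∃ (X''' : S) (τ'' : X'' ⟶ X'''), IsIso (F.map τ'') ∧ f ≫ τ'' = g ≫ τ'') := by
  have : Limits.PreservesColimitsOfSize.{0, 0} F := adj.leftAdjoint_preservesColimits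
  refine ⟨fun X => inferInstance, fun f g hf hg => ?_, fun τ σ hτ => ?_, fun τ f g hτ h => ?_⟩
  · rw [F.map_comp]
    infer_instance
  · exact ⟨_, Limits.pushout.inl τ σ, Limits.pushout.inr τ σ,
      ((IsPushout.of_hasPushout τ σ).map F).isIso_inr_of_isIso, Limits.pushout.condition⟩
  · have hF : F.map f = F.map g := by
      rw [← cancel_epi (F.map τ), ← F.map_comp, ← F.map_comp, h]
    exact ⟨_, Limits.coequalizer.π f g,
      Limits.isIso_colimit_cocone_parallelPair_of_eq hF
        (Limits.isColimitOfHasCoequalizerOfPreservesColimit F f g),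
      Limits.coequalizer.condition f g⟩
end

section
/- Let F ⊣ U : S ⇆ T be an adjunction with S cocomplete and U full and faithful, and let W be the class of morphisms τ of S such that F τ is an isomorphism. For objects H, Σ of S, the map sending a left fraction (σ : H → Σ', τ : Σ → Σ' with τ ∈ W) to (F τ)⁻¹ ∘ F σ : F H → F Σ induces a bijection between the set of equivalence classes of W-left fractions from H to Σ (two fractions being equivalent when they are connected by a zigzag of morphisms of fractions) and the hom-set Hom_T(F H, F Σ). -/
open CategoryTheory

/-- A left `F`-fraction from `H` to `X`: a cospan consisting of a numerator
`num : H ⟶ obj` and a denominator `denom : X ⟶ obj` such that `F denom` is an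
isomorphism. -/
structure FFraction {S : Type*} {T : Type*} [Category S] [Category T]
    (F : S ⥤ T) (H X : S) where
  obj : S
  num : H ⟶ obj
  denom : X ⟶ obj
  isIso : IsIso (F.map denom)

/-- The morphism `(F denom)⁻¹ ∘ F num : F H ⟶ F X` represented by a left fraction. -/
noncomputable def FFraction.toHom {S : Type*} {T : Type*} [Category S] [Category T]
    {F : S ⥤ T} {H X : S} (f : FFraction F H X) : F.obj H ⟶ F.obj X :=
  letI := f.isIso
  F.map f.num ≫ inv (F.map f.denom)

/-- Two fractions are related when there is a morphism of fractions from the first to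
the second, i.e. a morphism `α` between the vertices commuting with numerators and
denominators. (The quotient `Quot` of this relation identifies fractions connected by a
zigzag of morphisms of fractions.) -/
def FFractionRel {S : Type*} {T : Type*} [Category S] [Category T]
    {F : S ⥤ T} {H X : S} (f₁ f₂ : FFraction F H X) : Prop :=
  ∃ α : f₁.obj ⟶ f₂.obj, f₁.num ≫ α = f₂.num ∧ f₁.denom ≫ α = f₂.denom

/-- A morphism of fractions preserves the represented morphism. -/
theorem FFractionRel.toHom_eq {S : Type*} {T : Type*} [Category S] [Category T]
    {F : S ⥤ T} {H X : S} {f₁ f₂ : FFraction F H X} (h : FFractionRel f₁ f₂) :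
    f₁.toHom = f₂.toHom := by
  obtain ⟨α, hnum, hdenom⟩ := h
  have := f₁.isIso
  have := f₂.isIso
  dsimp only [FFraction.toHom]
  have hα : F.map f₁.denom ≫ F.map α = F.map f₂.denom := by rw [← F.map_comp, hdenom]
  rw [IsIso.eq_comp_inv, ← hα, ← hnum, F.map_comp]
  simp

/-- The fraction `H ⟶ U (F X) ⟵ X` whose numerator is the transpose of `φ : F H ⟶ F X` and
whose denominator is the unit. -/
def FFraction.ofHom {S : Type*} {T : Type*} [Category S] [Category T]
    {F : S ⥤ T} {U : T ⥤ S} (adj : F ⊣ U) [U.Full] [U.Faithful] {H X : S}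
    (φ : F.obj H ⟶ F.obj X) : FFraction F H X where
  obj := U.obj (F.obj X)
  num := adj.homEquiv _ _ φ
  denom := adj.unit.app X
  isIso := inferInstance

theorem FFraction.toHom_ofHom {S : Type*} {T : Type*} [Category S] [Category T]
    {F : S ⥤ T} {U : T ⥤ S} (adj : F ⊣ U) [U.Full] [U.Faithful] {H X : S}
    (φ : F.obj H ⟶ F.obj X) : (FFraction.ofHom adj φ).toHom = φ := by
  simp only [FFraction.toHom, FFraction.ofHom]
  rw [IsIso.comp_inv_eq, ← cancel_mono (adj.counit.app (F.obj X))]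
  simp [Adjunction.homEquiv_unit]

/-- Every fraction maps to the canonical fraction of the morphism it represents. -/
theorem FFraction.rel_ofHom_toHom {S : Type*} {T : Type*} [Category S] [Category T]
    {F : S ⥤ T} {U : T ⥤ S} (adj : F ⊣ U) [U.Full] [U.Faithful] {H X : S}
    (f : FFraction F H X) : FFractionRel f (FFraction.ofHom adj f.toHom) := by
  have := f.isIso
  refine ⟨adj.homEquiv _ _ (inv (F.map f.denom)), ?_, ?_⟩
  · exact (adj.homEquiv_naturality_left _ _).symm
  · change f.denom ≫ adj.homEquiv _ _ (inv (F.map f.denom)) = adj.unit.app X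
    rw [← adj.homEquiv_naturality_left, IsIso.hom_inv_id, adj.homEquiv_id]

/-- Let `F ⊣ U : S ⇆ T` be an adjunction with `S` cocomplete and `U` full
and faithful. For objects `H`, `X` of `S`, the map sending a left fraction `(σ, τ)` to
`(F τ)⁻¹ ∘ F σ` induces a bijection between the set of zigzag-equivalence classes of left
fractions from `H` to `X` and the hom-set `Hom_T(F H, F X)`. -/
theorem stmt11 {S : Type*} {T : Type*} [Category S] [Category T]
    (F : S ⥤ T) (U : T ⥤ S) (adj : F ⊣ U) [Limits.HasColimits S] [U.Full] [U.Faithful]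
    (H X : S) :
    ∃ e : Quot (FFractionRel (F := F) (H := H) (X := X)) ≃ (F.obj H ⟶ F.obj X),
      ∀ f : FFraction F H X, e (Quot.mk _ f) = f.toHom := by
  exact ⟨{
    toFun := Quot.lift FFraction.toHom fun _ _ h => h.toHom_eq
    invFun := fun φ => Quot.mk _ (FFraction.ofHom adj φ)
    left_inv := Quot.ind fun f => (Quot.sound (FFraction.rel_ofHom_toHom adj f)).symm
    right_inv := FFraction.toHom_ofHom adj }, fun _ => rfl⟩
end

section
/- Let F ⊣ U : S ⇆ T be an adjunction with S cocomplete and U full and faithful, and let W be the class of morphisms τ of S such that F τ is an isomorphism. Then the canonical localization functor L : S → S[W⁻¹] preserves all colimits. -/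
open CategoryTheory

/-- Let `F ⊣ U : S ⇆ T` be an adjunction with `S` cocomplete and `U` full
and faithful, and let `W` be the class of `F`-isomorphisms. Then the canonical
localization functor `L : S ⥤ S[W⁻¹]` preserves all colimits. -/
theorem stmt12 {S : Type*} {T : Type*} [Category S] [Category T]
    (F : S ⥤ T) (U : T ⥤ S) (adj : F ⊣ U) [Limits.HasColimits S] [U.Full] [U.Faithful] :
    Limits.PreservesColimits (fIsomorphisms F).Q := by
  have : F.IsLocalization (fIsomorphisms F) := adj.isLocalization
  let E := Localization.equivalenceFromModel F (fIsomorphisms F)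
  have adjQ : (fIsomorphisms F).Q ⊣ E.functor ⋙ U :=
    (adj.comp E.symm.toAdjunction).ofNatIsoLeft
      (Localization.compEquivalenceFromModelInverseIso F (fIsomorphisms F))
  exact adjQ.leftAdjoint_preservesColimits
end
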